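/- arXiv:1705.05484 — 2 statements merged into one kernel-verified Lean document; each statement's English description precedes it below -/
import Mathlib

section
/- Let I be a nonempty index set, 1 < p < ∞, and for each i ∈ I let A_i : X_i → Y_i be an operator with sup_i ‖A_i‖ < ∞. Define A on the ℓ_p(I)-direct sum X = (⊕_{i∈I} X_i)_{ℓ_p} into Y = (⊕_{i∈I} Y_i)_{ℓ_p} by A|_{X_i} = A_i. Then t_p(A) ≤ sup_{i∈I} max{t_p(A_i), ‖A_i‖}. -/
open Filter
open scoped Classical ENNReal NNReal

/-- A net in `X`: a function to `X` from a nonempty directed preorder. -/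
structure Net (X : Type*) where
  ι : Type
  pre : Preorder ι
  dir : IsDirected ι fun a b => pre.le a b
  ne : Nonempty ι
  toFun : ι → X

/-- The `atTop` filter of the index set of a net, along which limits are taken. -/
def Net.F {X : Type*} (N : Net X) : Filter N.ι := @Filter.atTop _ N.pre

variable {X Y : Type*} [NormedAddCommGroup X] [NormedSpace ℝ X]
  [NormedAddCommGroup Y] [NormedSpace ℝ Y]

/-- A net in a normed space is weakly null if it converges to `0` in the weak topology,
i.e. `f (x_λ) → 0` for every continuous linear functional `f`. -/
def WeaklyNullNet (N : Net X) : Prop :=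
  ∀ f : X →L[ℝ] ℝ, Tendsto (fun i => f (N.toFun i)) N.F (nhds 0)

/-- The net takes values in the ball of radius `σ`. -/
def NetInBall (N : Net X) (σ : ℝ) : Prop := ∀ i, ‖N.toFun i‖ ≤ σ

/-- The modulus of asymptotic uniform smoothness of an operator `A : X → Y`:
`ρ(σ, A) = sup { limsup_λ ‖y + A x_λ‖ - 1 }` over `y ∈ B_Y` and weakly null nets
`(x_λ) ⊆ σ B_X`, with `ρ(σ, A) = 0` for the zero operator. -/
noncomputable def rho (A : X →L[ℝ] Y) (σ : ℝ) : ℝ :=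
  if A = 0 then 0 else
    sSup {r : ℝ | ∃ (N : Net X) (y : Y), ‖y‖ ≤ 1 ∧ NetInBall N σ ∧ WeaklyNullNet N ∧
      r = Filter.limsup (fun i => ‖y + A (N.toFun i)‖) N.F - 1}

/-- `tp A p` is the infimum (in `ℝ≥0∞`, so `∞` if no such constant exists) of the
constants `C > 0` such that for every `y ∈ Y`, every `σ > 0`, and every weakly null
net `(x_λ) ⊆ σ B_X`, `limsup_λ ‖y + A x_λ‖^p ≤ ‖y‖^p + C^p σ^p`. -/
noncomputable def tp (A : X →L[ℝ] Y) (p : ℝ) : ℝ≥0∞ :=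
  sInf (ENNReal.ofReal '' {C : ℝ | 0 < C ∧ ∀ (y : Y) (σ : ℝ), 0 < σ →
    ∀ N : Net X, NetInBall N σ → WeaklyNullNet N →
      Filter.limsup (fun i => ‖y + A (N.toFun i)‖ ^ p) N.F ≤ ‖y‖ ^ p + C ^ p * σ ^ p})

theorem Net.neBot {X : Type*} (N : Net X) : N.F.NeBot := by
  let := N.pre
  have := N.ne
  have : IsDirectedOrder N.ι := N.dir
  exact (inferInstance : (atTop : Filter N.ι).NeBot)

/-- restriction of a net to a cofinal set -/
theorem Net.exists_sub {X : Type*} (N : Net X) (P : N.ι → Prop) (hP : ∃ᶠ i in N.F, P i) :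
    ∃ (M : Net X) (g : M.ι → N.ι), Tendsto g M.F N.F ∧ (∀ j, P (g j)) ∧
      ∀ j, M.toFun j = N.toFun (g j) := by
  let := N.pre
  have := N.ne
  have : IsDirectedOrder N.ι := N.dir
  have hP' : ∀ a : N.ι, ∃ b, a ≤ b ∧ P b := fun a => by
    have h : ∃ᶠ i in (atTop : Filter N.ι), P i := hP
    obtain ⟨b, hb, hb'⟩ := (frequently_atTop.1 h) a
    exact ⟨b, hb, hb'⟩
  have hd : IsDirected {i // P i} fun a b => a ≤ b := ⟨fun a b => by
    obtain ⟨c, hac, hbc⟩ := exists_ge_ge a.1 b.1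
    obtain ⟨d, hcd, hd⟩ := hP' c
    exact ⟨⟨d, hd⟩, hac.trans hcd, hbc.trans hcd⟩⟩
  have hn : Nonempty {i // P i} := by
    obtain ⟨a⟩ := N.ne
    obtain ⟨b, _, hb⟩ := hP' a
    exact ⟨⟨b, hb⟩⟩
  refine ⟨⟨{i // P i}, inferInstance, hd, hn, fun j => N.toFun j.1⟩, fun j => j.1, ?_,
    fun j => j.2, fun j => rfl⟩
  change Tendsto (fun j : {i // P i} => j.1) atTop atTop
  refine tendsto_atTop.2 fun a => ?_
  obtain ⟨b, hab, hb⟩ := hP' a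
  filter_upwards [eventually_ge_atTop (⟨b, hb⟩ : {i // P i})] with j hj
  exact hab.trans hj

/-- the bounds used in the definition of `tp` -/
def GoodC {X Y : Type*} [NormedAddCommGroup X] [NormedSpace ℝ X]
    [NormedAddCommGroup Y] [NormedSpace ℝ Y] (A : X →L[ℝ] Y) (p C : ℝ) : Prop :=
  ∀ (y : Y) (σ : ℝ), 0 < σ →
    ∀ N : Net X, NetInBall N σ → WeaklyNullNet N →
      Filter.limsup (fun i => ‖y + A (N.toFun i)‖ ^ p) N.F ≤ ‖y‖ ^ p + C ^ p * σ ^ p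

theorem goodC_of_tp_lt {X Y : Type*} [NormedAddCommGroup X] [NormedSpace ℝ X]
    [NormedAddCommGroup Y] [NormedSpace ℝ Y] (A : X →L[ℝ] Y) (p C : ℝ) (hp : 0 ≤ p) (hC : 0 ≤ C)
    (h : tp A p < ENNReal.ofReal C) : GoodC A p C := by
  unfold tp at h
  rw [sInf_lt_iff] at h
  obtain ⟨_, ⟨C', ⟨hC', h'⟩, rfl⟩, hlt⟩ := h
  have hle : C' ≤ C := (ENNReal.ofReal_le_ofReal_iff hC).1 hlt.le
  intro y σ hσ N hN hw
  refine (h' y σ hσ N hN hw).trans ?_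
  gcongr

theorem bdd_net {X Y : Type*} [NormedAddCommGroup X] [NormedSpace ℝ X]
    [NormedAddCommGroup Y] [NormedSpace ℝ Y] (A : X →L[ℝ] Y) (p : ℝ) (hp : 0 ≤ p)
    (y : Y) (σ : ℝ) (N : Net X) (hN : NetInBall N σ) :
    IsBoundedUnder (· ≤ ·) N.F (fun i => ‖y + A (N.toFun i)‖ ^ p) := by
  refine isBoundedUnder_of ⟨(‖y‖ + ‖A‖ * σ) ^ p, fun i => ?_⟩
  gcongr
  refine (norm_add_le _ _).trans ?_
  gcongr
  refine (A.le_opNorm _).trans ?_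
  gcongr
  exact hN i

theorem cobdd_net {X Y : Type*} [NormedAddCommGroup X] [NormedSpace ℝ X]
    [NormedAddCommGroup Y] [NormedSpace ℝ Y] (A : X →L[ℝ] Y) (p : ℝ)
    (y : Y) (N : Net X) :
    IsCoboundedUnder (· ≤ ·) N.F (fun i => ‖y + A (N.toFun i)‖ ^ p) := by
  have := N.neBot
  have : IsBoundedUnder (· ≥ ·) N.F (fun i => ‖y + A (N.toFun i)‖ ^ p) :=
    isBoundedUnder_of ⟨0, fun i => by positivity⟩
  exact this.isCoboundedUnder_le

theorem single_bound {X Y : Type*} [NormedAddCommGroup X] [NormedSpace ℝ X]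
    [NormedAddCommGroup Y] [NormedSpace ℝ Y] (A : X →L[ℝ] Y) (p C : ℝ) (hp : 0 < p)
    (h : GoodC A p C) (y : Y) (σ : ℝ) (N : Net X) (hN : NetInBall N σ)
    (hw : WeaklyNullNet N) (ε : ℝ) (hε : 0 < ε) :
    ∀ᶠ i in N.F, ‖y + A (N.toFun i)‖ ^ p ≤ ‖y‖ ^ p + C ^ p * ‖N.toFun i‖ ^ p + ε := by
  by_contra hcon
  rw [not_eventually] at hcon
  have hfr : ∃ᶠ i in N.F, ‖N.toFun i‖ ∈ Set.Icc 0 σ ∧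
      ¬ (‖y + A (N.toFun i)‖ ^ p ≤ ‖y‖ ^ p + C ^ p * ‖N.toFun i‖ ^ p + ε) :=
    hcon.mono fun i hi => ⟨⟨norm_nonneg _, hN i⟩, hi⟩
  obtain ⟨r, hr, hcl⟩ : ∃ r ∈ Set.Icc (0:ℝ) σ, ∀ U ∈ nhds r, ∃ᶠ i in N.F, ‖N.toFun i‖ ∈ U ∧
      ¬ (‖y + A (N.toFun i)‖ ^ p ≤ ‖y‖ ^ p + C ^ p * ‖N.toFun i‖ ^ p + ε) := by
    set Q : N.ι → Prop := fun i =>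
      ¬ (‖y + A (N.toFun i)‖ ^ p ≤ ‖y‖ ^ p + C ^ p * ‖N.toFun i‖ ^ p + ε) with hQ
    have : (N.F ⊓ 𝓟 {i | Q i}).NeBot := frequently_mem_iff_neBot.1 hcon
    obtain ⟨r, hr, hc⟩ := (isCompact_Icc (a := (0:ℝ)) (b := σ)).exists_mapClusterPt
      (f := N.F ⊓ 𝓟 {i | Q i}) (u := fun i => ‖N.toFun i‖)
      (tendsto_principal.2 (Eventually.of_forall fun i => ⟨norm_nonneg _, hN i⟩))
    refine ⟨r, hr, fun U hU => ?_⟩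
    have := hc.frequently hU
    rw [frequently_inf_principal] at this
    exact this.mono fun i hi => ⟨hi.2, hi.1⟩
  have hcont : Continuous fun s : ℝ => C ^ p * s ^ p :=
    continuous_const.mul (Real.continuous_rpow_const hp.le)
  obtain ⟨τ, hτ1, hτ2⟩ : ∃ τ, C ^ p * τ ^ p < C ^ p * r ^ p + ε ∧ r < τ := by
    have h1 : ∀ᶠ τ in nhds r, C ^ p * τ ^ p < C ^ p * r ^ p + ε :=
      hcont.continuousAt.eventually_lt continuousAt_const (by simpa using hε)
    have h2 : ∀ᶠ τ in nhdsWithin r (Set.Ioi r), C ^ p * τ ^ p < C ^ p * r ^ p + ε :=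
      h1.filter_mono nhdsWithin_le_nhds
    exact (h2.and self_mem_nhdsWithin).exists
  have hτ0 : 0 < τ := lt_of_le_of_lt hr.1 hτ2
  obtain ⟨s, hs1, hs2⟩ := exists_between hτ1
  have hU : ∀ᶠ t in nhds r, t < τ ∧ s < C ^ p * t ^ p + ε :=
    (eventually_lt_nhds hτ2).and
      (continuousAt_const.eventually_lt (hcont.continuousAt.add continuousAt_const) hs2)
  obtain ⟨M, g, hg, hP, hM⟩ := N.exists_sub _ (hcl _ hU)
  have := M.neBot
  have hMb : NetInBall M τ := fun j => by rw [hM]; exact (hP j).1.1.le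
  have hMw : WeaklyNullNet M := fun f => by
    simp only [hM]
    exact (hw f).comp hg
  have hl := h y τ hτ0 M hMb hMw
  have hlt : limsup (fun i => ‖y + A (M.toFun i)‖ ^ p) M.F < ‖y‖ ^ p + s :=
    lt_of_le_of_lt hl (by linarith)
  obtain ⟨j, hj⟩ := (eventually_lt_of_limsup_lt hlt (bdd_net A p hp.le y τ M hMb)).exists
  rw [hM] at hj
  have h1 := (hP j).2
  have h2 := (hP j).1.2
  rw [not_le] at h1
  linarith

theorem lp_bound {I : Type} (E : I → Type) (F : I → Type)
    [∀ i, NormedAddCommGroup (E i)] [∀ i, NormedSpace ℝ (E i)]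
    [∀ i, NormedAddCommGroup (F i)] [∀ i, NormedSpace ℝ (F i)]
    (p : ℝ≥0∞) [Fact (1 ≤ p)] (hp : 1 < p) (hp' : p ≠ ⊤)
    (T : ∀ i, E i →L[ℝ] F i)
    (A : lp E p →L[ℝ] lp F p)
    (hA : ∀ (x : lp E p) (i : I), (A x : ∀ i, F i) i = T i ((x : ∀ i, E i) i))
    (C : ℝ) (hC : 0 < C) (hT : ∀ i, ‖T i‖ ≤ C) (hG : ∀ i, GoodC (T i) p.toReal C) :
    GoodC A p.toReal C := by
  have hp0 : 0 < p.toReal := ENNReal.toReal_pos (by positivity) hp'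
  set q := p.toReal with hq
  intro y σ hσ N hN hw
  have := N.neBot
  set K := ‖y‖ ^ q + C ^ q * σ ^ q with hK
  have hK0 : 0 ≤ K := by positivity
  -- eventual bound
  have key : ∀ ε > 0, ∀ᶠ l in N.F, ‖y + A (N.toFun l)‖ ^ q ≤ (ε + (K + ε) ^ q⁻¹) ^ q := by
    intro ε hε
    obtain ⟨S, hS⟩ : ∃ S : Finset I, ‖y - ∑ i ∈ S, lp.single p i (y i)‖ < ε := by
      have h1 := lp.hasSum_single hp' y
      have h2 := (Metric.tendsto_nhds.1 h1 ε hε).exists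
      obtain ⟨S, hS⟩ := h2
      exact ⟨S, by rwa [dist_comm, dist_eq_norm] at hS⟩
    set y' := ∑ i ∈ S, lp.single p i (y i) with hy'
    have hy'c : ∀ i, y' i = if i ∈ S then y i else 0 := by
      intro i
      rw [hy', lp.coeFn_sum, Finset.sum_apply]
      simp [lp.single_apply, Pi.single_apply]
    set δ := ε / (S.card + 1) with hδ
    have hδ0 : 0 < δ := by positivity
    have hSδ : S.card * δ ≤ ε := by
      rw [hδ, mul_div_assoc', div_le_iff₀ (by positivity)]
      nlinarith
    have hco : ∀ i, ∀ᶠ l in N.F, ‖y i + T i (N.toFun l i)‖ ^ q ≤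
        ‖y i‖ ^ q + C ^ q * ‖N.toFun l i‖ ^ q + δ := by
      intro i
      let π : lp E p →L[ℝ] E i := LinearMap.mkContinuous
        { toFun := fun x => x i, map_add' := fun _ _ => rfl, map_smul' := fun _ _ => rfl } 1
        (fun x => by
          rw [one_mul]; exact lp.norm_apply_le_norm (by positivity) x i)
      let N' : Net (E i) := ⟨N.ι, N.pre, N.dir, N.ne, fun l => N.toFun l i⟩
      exact single_bound (T i) q C hp0 (hG i) (y i) σ N'
        (fun l => (lp.norm_apply_le_norm (by positivity) (N.toFun l) i).trans (hN l))
        (fun f => hw (f.comp π)) δ hδ0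
    have hall : ∀ᶠ l in N.F, ∀ i ∈ S, ‖y i + T i (N.toFun l i)‖ ^ q ≤
        ‖y i‖ ^ q + C ^ q * ‖N.toFun l i‖ ^ q + δ :=
      (Filter.eventually_all_finset S).2 fun i _ => hco i
    filter_upwards [hall] with l hl
    set x := N.toFun l with hx
    have hz := lp.hasSum_norm hp0 (y' + A x)
    have hxs := (lp.hasSum_norm hp0 x).mul_left (C ^ q)
    have hfin : HasSum (fun i => if i ∈ S then ‖y i‖ ^ q + δ else 0)
        (∑ i ∈ S, (‖y i‖ ^ q + δ)) := by
      have := hasSum_sum_of_ne_finset_zero (L := SummationFilter.unconditional I) (f := fun i => if i ∈ S then ‖y i‖ ^ q + δ else 0)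
        (s := S) (fun i hi => by simp [hi])
      convert this using 1
      exact Finset.sum_congr rfl fun i hi => by simp [hi]
    have hle := hasSum_le (fun i => ?_) hz (hfin.add hxs)
    · have hys : ∑ i ∈ S, ‖y i‖ ^ q ≤ ‖y‖ ^ q :=
        sum_le_hasSum S (fun i _ => by positivity) (lp.hasSum_norm hp0 y)
      have hxσ : C ^ q * ‖x‖ ^ q ≤ C ^ q * σ ^ q := by
        gcongr
        exact hN l
      rw [Finset.sum_add_distrib, Finset.sum_const, nsmul_eq_mul] at hle
      have h3 : ‖y' + A x‖ ^ q ≤ K + ε := by linarith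
      have h4 : ‖y' + A x‖ ≤ (K + ε) ^ q⁻¹ :=
        (Real.le_rpow_inv_iff_of_pos (norm_nonneg _) (by positivity) hp0).2 h3
      gcongr
      calc ‖y + A x‖ = ‖(y - y') + (y' + A x)‖ := by congr 1; abel
        _ ≤ ‖y - y'‖ + ‖y' + A x‖ := norm_add_le _ _
        _ ≤ _ := add_le_add hS.le h4
    · have hz' : (y' + A x) i = y' i + T i (x i) := by
        rw [← hA]; rfl
      simp only [hz', hy'c]
      by_cases hi : i ∈ S
      · simp only [hi, if_true]
        have := hl i hi
        linarith
      · simp only [hi, if_false, zero_add]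
        rw [← Real.mul_rpow hC.le (norm_nonneg _)]
        gcongr
        exact (T i).le_of_opNorm_le (hT i) _
  have hlim : Tendsto (fun ε : ℝ => (ε + (K + ε) ^ q⁻¹) ^ q) (nhdsWithin 0 (Set.Ioi 0))
      (nhds K) := by
    have hc : Continuous fun ε : ℝ => (ε + (K + ε) ^ q⁻¹) ^ q :=
      (Real.continuous_rpow_const hp0.le).comp (continuous_id.add
        ((Real.continuous_rpow_const (inv_nonneg.2 hp0.le)).comp
          (continuous_const.add continuous_id)))
    have := (hc.tendsto 0).mono_left (nhdsWithin_le_nhds (s := Set.Ioi 0))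
    simpa [Real.rpow_inv_rpow hK0 hp0.ne'] using this
  refine ge_of_tendsto hlim ?_
  filter_upwards [self_mem_nhdsWithin] with ε hε
  exact limsup_le_of_le (cobdd_net A q y N) (key ε hε)

/-- For a uniformly bounded family of operators `A_i : X_i → Y_i` and `1 < p < ∞`, the
induced diagonal operator `A` between the `ℓ_p`-direct sums satisfies
`t_p(A) ≤ sup_i max (t_p(A_i), ‖A_i‖)`. -/
theorem tp_lp_sum {I : Type} [Nonempty I] (E : I → Type) (F : I → Type)
    [∀ i, NormedAddCommGroup (E i)] [∀ i, NormedSpace ℝ (E i)]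
    [∀ i, NormedAddCommGroup (F i)] [∀ i, NormedSpace ℝ (F i)]
    (p : ℝ≥0∞) [Fact (1 ≤ p)] (hp : 1 < p) (hp' : p ≠ ⊤)
    (T : ∀ i, E i →L[ℝ] F i) (hbd : BddAbove (Set.range fun i => ‖T i‖))
    (A : lp E p →L[ℝ] lp F p)
    (hA : ∀ (x : lp E p) (i : I), (A x : ∀ i, F i) i = T i ((x : ∀ i, E i) i)) :
    tp A p.toReal ≤ ⨆ i : I, max (tp (T i) p.toReal) (ENNReal.ofReal ‖T i‖) := by
  refine le_of_forall_gt fun b hb => ?_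
  obtain ⟨c, hc1, hc2⟩ := ENNReal.lt_iff_exists_nnreal_btwn.1 hb
  refine lt_of_le_of_lt ?_ hc2
  have hc0 : (0 : ℝ) < c := by
    have : (0 : ℝ≥0∞) < c := lt_of_le_of_lt bot_le hc1
    exact_mod_cast this
  have hcc : ENNReal.ofReal (c : ℝ) = c := ENNReal.ofReal_coe_nnreal
  have hi : ∀ i, max (tp (T i) p.toReal) (ENNReal.ofReal ‖T i‖) < ENNReal.ofReal (c : ℝ) :=
    fun i => by
      rw [hcc]
      exact lt_of_le_of_lt (le_iSup (fun i => max (tp (T i) p.toReal) (ENNReal.ofReal ‖T i‖)) i) hc1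
  rw [← hcc]
  refine sInf_le ⟨c, ⟨hc0, ?_⟩, rfl⟩
  refine lp_bound E F p hp hp' T A hA c hc0 (fun i => ?_) (fun i => ?_)
  · exact (ENNReal.ofReal_le_ofReal_iff hc0.le).1 ((le_max_right _ _).trans (hi i).le)
  · exact goodC_of_tp_lt _ _ _ ENNReal.toReal_nonneg hc0.le (lt_of_le_of_lt (le_max_left _ _) (hi i))
end

section
/- Let A : X → Y be an operator with t_∞(A) < ∞. Then for every C > t_∞(A), A satisfies C-c₀ upper tree estimates; hence T_∞(A) ≤ t_∞(A). -/
open Filter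
open scoped Classical ENNReal NNReal

section Combinatorics

variable {D : Type*} [Preorder D]

/-- A subset of a directed set is cofinal if every element has an upper bound in it. -/
def Cofinal (S : Set D) : Prop := ∀ u : D, ∃ v ∈ S, u ≤ v

/-- A subset is eventual if its complement is not cofinal. -/
def Eventual (S : Set D) : Prop := ¬ Cofinal Sᶜ

/-- Inevitable subsets of the tree of nonempty finite sequences from `D`. -/
def Inevitable (B : Set (List D)) : Prop :=
  Eventual {u : D | [u] ∈ B} ∧
    ∀ t ∈ B, t ≠ [] → Eventual {u : D | t ++ [u] ∈ B}

/-- A set of finite sequences is big if it contains an inevitable subset. -/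
def Big (B : Set (List D)) : Prop := ∃ B' : Set (List D), B' ⊆ B ∧ Inevitable B'

end Combinatorics

/-- The canonical weak neighborhood basis at `0` in `X`: basic weak neighborhoods are
indexed by a finite set of functionals and a positive `ε`. -/
def WNbhd (X : Type*) [NormedAddCommGroup X] [NormedSpace ℝ X] : Type _ :=
  Finset (X →L[ℝ] ℝ) × {ε : ℝ // 0 < ε}

variable {X Y : Type*} [NormedAddCommGroup X] [NormedSpace ℝ X]
  [NormedAddCommGroup Y] [NormedSpace ℝ Y]

/-- The basic weak neighborhood of `0` determined by `u ∈ WNbhd X`. -/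
def wset (u : WNbhd X) : Set X := {x | ∀ f ∈ u.1, |f x| < u.2.1}

/-- `WNbhd X` is directed by reverse inclusion of the associated neighborhoods. -/
instance : Preorder (WNbhd X) :=
  Preorder.lift fun u : WNbhd X => OrderDual.toDual (wset u)

/-- A collection `(x_t)` indexed by the nonempty finite sequences from the weak
neighborhood basis is normally weakly null (and contained in `B_X`) if
`x_t ∈ B_X ∩ u_n` whenever `t = (u_1, …, u_n)`. -/
def NormallyWeaklyNull (x : List (WNbhd X) → X) : Prop :=
  ∀ (t : List (WNbhd X)) (u : WNbhd X), ‖x (t ++ [u])‖ ≤ 1 ∧ x (t ++ [u]) ∈ wset u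

/-- Membership of `(a_1, …, a_n)` in the unit ball of `ℓ_p^n` (`ℓ_∞^n` when `p = ∞`). -/
def pBall (p : ℝ≥0∞) (n : ℕ) (a : ℕ → ℝ) : Prop :=
  if p = ⊤ then ∀ i < n, |a i| ≤ 1
  else ∑ i ∈ Finset.range n, |a i| ^ p.toReal ≤ 1

/-- `A` satisfies `C`-`ℓ_p` upper tree estimates (`C`-`c₀` when `p = ∞`) if for every
normally weakly null collection `(x_t) ⊆ B_X`, the set of `t` such that
`‖A ∑_{i ≤ |t|} a_i x_{t|_i}‖ ≤ C ‖(a_i)‖_{ℓ_p}` for all scalars is big. -/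
def SatisfiesUpperTreeEst (A : X →L[ℝ] Y) (p : ℝ≥0∞) (C : ℝ) : Prop :=
  ∀ x : List (WNbhd X) → X, NormallyWeaklyNull x →
    Big {t : List (WNbhd X) | ∀ a : ℕ → ℝ, pBall p t.length a →
      ‖A (∑ i ∈ Finset.range t.length, a i • x (t.take (i + 1)))‖ ≤ C}

/-- `T_p(A)`: the infimum (in `ℝ≥0∞`, so `∞` if no such constant exists) of the
constants `C > 0` such that `A` satisfies `C`-`ℓ_p` upper tree estimates. -/
noncomputable def upperTreeConst (A : X →L[ℝ] Y) (p : ℝ≥0∞) : ℝ≥0∞ :=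
  sInf (ENNReal.ofReal '' {C : ℝ | 0 < C ∧ SatisfiesUpperTreeEst A p C})

/-- `tInf A` (the quantity `t_∞(A)`) is the infimum (in `ℝ≥0∞`, so `∞` if no such
constant exists) of the constants `C₀ > 0` such that for every `y ∈ Y`, every
`σ > 0`, and every weakly null net `(x_λ) ⊆ σ B_X`,
`limsup_λ ‖y + A x_λ‖ ≤ max (‖y‖) (C₀ σ)`. -/
noncomputable def tInf (A : X →L[ℝ] Y) : ℝ≥0∞ :=
  sInf (ENNReal.ofReal '' {C : ℝ | 0 < C ∧ ∀ (y : Y) (σ : ℝ), 0 < σ →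
    ∀ N : Net X, NetInBall N σ → WeaklyNullNet N →
      Filter.limsup (fun i => ‖y + A (N.toFun i)‖) N.F ≤ max ‖y‖ (C * σ)})

lemma kap_fin {ι : Type*} (x : ι → X)
    (h : ∀ (Fs : Finset (X →L[ℝ] ℝ)) (ε : ℝ), 0 < ε → ∃ i, ∀ f ∈ Fs, |f (x i)| < ε)
    (n : ℕ) (R ε : ℝ) (hε : 0 < ε) :
    ∃ T : Finset ι, ∀ g : Fin n → (X →L[ℝ] ℝ), (∀ j, ‖g j‖ ≤ R) →
      ∃ i ∈ T, ∀ j, |g j (x i)| < ε := by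
  have hK : IsCompact (Set.pi Set.univ (fun _ : Fin n =>
      (WeakDual.toStrongDual ⁻¹' Metric.closedBall (0 : StrongDual ℝ X) R : Set (WeakDual ℝ X)))) :=
    isCompact_univ_pi fun _ => WeakDual.isCompact_closedBall 0 R
  obtain ⟨T, hT⟩ := hK.elim_finite_subcover
    (fun i : ι => {g : Fin n → WeakDual ℝ X | ∀ j, |g j (x i)| < ε}) (by
      intro i
      rw [Set.setOf_forall]
      refine isOpen_iInter_of_finite fun j => ?_
      refine isOpen_lt ?_ continuous_const
      exact ((WeakDual.eval_continuous (x i)).comp (continuous_apply j)).abs) (by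
      intro g _
      obtain ⟨i, hi⟩ := h (Finset.univ.image fun j => WeakDual.toStrongDual (g j)) ε hε
      refine Set.mem_iUnion.2 ⟨i, fun j => ?_⟩
      exact hi _ (Finset.mem_image_of_mem _ (Finset.mem_univ j)))
  refine ⟨T, fun g hg => ?_⟩
  have := hT (a := fun j => StrongDual.toWeakDual (g j)) (by
    intro j _
    simpa using hg j)
  simp only [Set.mem_iUnion] at this
  obtain ⟨i, hi, hi'⟩ := this
  exact ⟨i, hi, hi'⟩

/-- Kaplansky: countable tightness of the weak topology. -/
lemma kap {ι : Type*} (x : ι → X)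
    (h : ∀ (Fs : Finset (X →L[ℝ] ℝ)) (ε : ℝ), 0 < ε → ∃ i, ∀ f ∈ Fs, |f (x i)| < ε) :
    ∃ s : ℕ → ι, ∀ (Fs : Finset (X →L[ℝ] ℝ)) (ε : ℝ), 0 < ε →
      ∃ i, ∀ f ∈ Fs, |f (x (s i))| < ε := by
  choose T hT using fun (p : ℕ × ℕ × ℕ) =>
    kap_fin x h p.1 (p.2.1 : ℝ) (1 / ((p.2.2 : ℝ) + 1)) (by positivity)
  have key : ∀ (Fs : Finset (X →L[ℝ] ℝ)) (ε : ℝ), 0 < ε →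
      ∃ i ∈ ⋃ p, (T p : Set ι), ∀ f ∈ Fs, |f (x i)| < ε := by
    intro Fs ε hε
    obtain ⟨k, hk⟩ := exists_nat_one_div_lt hε
    obtain ⟨R, hR⟩ := exists_nat_ge (∑ f ∈ Fs, ‖f‖)
    obtain ⟨i, hi, hi'⟩ := hT (Fs.card, R, k) (fun j => (Fs.equivFin.symm j : X →L[ℝ] ℝ)) (by
      intro j
      refine le_trans ?_ hR
      exact Finset.single_le_sum (f := fun f : X →L[ℝ] ℝ => ‖f‖)
        (fun _ _ => norm_nonneg _) (Fs.equivFin.symm j).2)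
    refine ⟨i, Set.mem_iUnion.2 ⟨_, hi⟩, fun f hf => ?_⟩
    have := hi' (Fs.equivFin ⟨f, hf⟩)
    simp only [Equiv.symm_apply_apply] at this
    exact this.trans hk
  obtain ⟨i0, hi0, -⟩ := key ∅ 1 one_pos
  obtain ⟨s, hs⟩ := (Set.countable_iUnion fun p => (T p).countable_toSet).exists_eq_range ⟨i0, hi0⟩
  refine ⟨s, fun Fs ε hε => ?_⟩
  obtain ⟨i, hi, hi'⟩ := key Fs ε hε
  rw [hs] at hi
  obtain ⟨n, rfl⟩ := hi
  exact ⟨n, hi'⟩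

lemma exists_ultra {ι : Type*} (x : ι → X)
    (h : ∀ (Fs : Finset (X →L[ℝ] ℝ)) (ε : ℝ), 0 < ε → ∃ i, ∀ f ∈ Fs, |f (x i)| < ε) :
    ∃ U : Ultrafilter ι, ∀ f : X →L[ℝ] ℝ, Tendsto (fun n => f (x n)) U (nhds 0) := by
  let e : ι → ((X →L[ℝ] ℝ) → ℝ) := fun n f => f (x n)
  have hne : (comap e (nhds 0)).NeBot := by
    rw [comap_neBot_iff]
    intro t ht
    rw [nhds_pi, Filter.mem_pi'] at ht
    obtain ⟨Fs, W, hW, hWt⟩ := ht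
    have : ∀ f : X →L[ℝ] ℝ, ∃ ε > 0, Metric.ball (0 : ℝ) ε ⊆ W f := fun f =>
      Metric.mem_nhds_iff.1 (hW f)
    choose r hr hrW using this
    obtain ⟨ε, hε, hεr⟩ : ∃ ε : ℝ, 0 < ε ∧ ∀ f ∈ Fs, ε ≤ r f := by
      rcases Fs.eq_empty_or_nonempty with rfl | hF
      · exact ⟨1, one_pos, by simp⟩
      · exact ⟨Fs.inf' hF r, (Finset.lt_inf'_iff hF).2 fun f _ => hr f,
          fun f hf => Finset.inf'_le _ hf⟩
    obtain ⟨i, hi⟩ := h Fs ε hε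
    refine ⟨i, hWt fun f hf => hrW f ?_⟩
    rw [mem_ball_zero_iff, Real.norm_eq_abs]
    exact (hi f hf).trans_le (hεr f hf)
  refine ⟨@Ultrafilter.of _ (comap e (nhds 0)) hne, fun f => ?_⟩
  have h1 : Tendsto e (@Ultrafilter.of _ (comap e (nhds 0)) hne) (nhds 0) :=
    tendsto_comap.mono_left (Ultrafilter.of_le _)
  exact (tendsto_pi_nhds.1 h1) f

/-- The net associated with an ultrafilter on `ℕ`. -/
def ultraNet (U : Ultrafilter ℕ) (z : ℕ → X) : Net X where
  ι := {p : ℕ × Set ℕ // p.2 ∈ U ∧ p.1 ∈ p.2}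
  pre := Preorder.lift fun p => OrderDual.toDual p.1.2
  dir := ⟨fun a b => by
    have hm : a.1.2 ∩ b.1.2 ∈ U := Filter.inter_mem a.2.1 b.2.1
    obtain ⟨n, hn⟩ := U.nonempty_of_mem hm
    exact ⟨⟨(n, a.1.2 ∩ b.1.2), hm, hn⟩, Set.inter_subset_left, Set.inter_subset_right⟩⟩
  ne := ⟨⟨(0, Set.univ), Filter.univ_mem, trivial⟩⟩
  toFun p := z p.1.1

lemma ultraNet_tendsto (U : Ultrafilter ℕ) (z : ℕ → X) :
    Tendsto (fun p : (ultraNet U z).ι => p.1.1) (ultraNet U z).F U := by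
  intro W hW
  obtain ⟨n, hn⟩ := U.nonempty_of_mem hW
  letI := (ultraNet U z).pre
  refine Filter.mem_map.2 (Filter.mem_of_superset (@Filter.mem_atTop _ (ultraNet U z).pre (⟨(n, W), hW, hn⟩ : (ultraNet U z).ι)) ?_)
  intro p hp
  exact hp p.2.2

lemma net_neBot (N : Net X) : N.F.NeBot := by
  letI := N.pre
  haveI := N.dir
  haveI := N.ne
  exact Filter.atTop_neBot

lemma main_step (A : X →L[ℝ] Y) {C' c d : ℝ} (hc : C' ≤ c) (hcd : c < d)
    (hC : ∀ (y : Y) (σ : ℝ), 0 < σ →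
      ∀ N : Net X, NetInBall N σ → WeaklyNullNet N →
      Filter.limsup (fun i => ‖y + A (N.toFun i)‖) N.F ≤ max ‖y‖ (C' * σ))
    {n : ℕ} (w : Fin n → X)
    (hw : ∀ a : Fin n → ℝ, (∀ i, |a i| ≤ 1) → ‖A (∑ i, a i • w i)‖ ≤ c)
    {ι : Type*} (x : ι → X) (hx : ∀ i, ‖x i‖ ≤ 1)
    (h : ∀ (Fs : Finset (X →L[ℝ] ℝ)) (ε : ℝ), 0 < ε → ∃ i, ∀ f ∈ Fs, |f (x i)| < ε)
    (a : ι → Fin n → ℝ) (b : ι → ℝ) (ha : ∀ i j, |a i j| ≤ 1) (hb : ∀ i, |b i| ≤ 1)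
    (hbad : ∀ i, d < ‖A (∑ j, a i j • w j + b i • x i)‖) : False := by
  obtain ⟨s, hs⟩ := kap x h
  obtain ⟨U, hU⟩ := exists_ultra (fun n => x (s n)) hs
  have hK : IsCompact (Set.pi Set.univ (fun _ : Fin n => Set.Icc (-1 : ℝ) 1)) :=
    isCompact_univ_pi fun _ => isCompact_Icc
  obtain ⟨a0, ha0, hla⟩ := hK.ultrafilter_le_nhds (U.map fun m => a (s m)) (by
    rw [Ultrafilter.coe_map, le_principal_iff]
    exact Filter.mem_map.2 (Filter.univ_mem' fun m j _ => abs_le.1 (ha (s m) j)))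
  obtain ⟨b0, hb0, hlb⟩ := (isCompact_Icc (a := (-1 : ℝ)) (b := 1)).ultrafilter_le_nhds
    (U.map fun m => b (s m)) (by
    rw [Ultrafilter.coe_map, le_principal_iff]
    exact Filter.mem_map.2 (Filter.univ_mem' fun m => abs_le.1 (hb (s m))))
  have hla : Tendsto (fun m => a (s m)) U (nhds a0) := hla
  have hlb : Tendsto (fun m => b (s m)) U (nhds b0) := hlb
  set y : Y := A (∑ j, a0 j • w j) with hy
  have hyc : ‖y‖ ≤ c := hw a0 fun i => abs_le.2 (ha0 i trivial)
  have hb0' : |b0| ≤ 1 := abs_le.2 hb0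
  let N := ultraNet U (fun m => b0 • x (s m))
  have hball : NetInBall N 1 := by
    intro p
    change ‖b0 • x (s p.1.1)‖ ≤ 1
    rw [norm_smul, Real.norm_eq_abs]
    exact mul_le_one₀ hb0' (norm_nonneg _) (hx _)
  have hnull : WeaklyNullNet N := by
    intro f
    have h1 : Tendsto (fun m => f (b0 • x (s m))) U (nhds 0) := by
      simpa using (hU f).const_mul b0
    exact h1.comp (ultraNet_tendsto U _)
  have hlim := hC y 1 one_pos N hball hnull
  have hd : ∀ᶠ m in (U : Filter ℕ), (c + d) / 2 ≤ ‖y + A (b0 • x (s m))‖ := by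
    have h1 : Tendsto (fun m => A (∑ j, a (s m) j • w j)) U (nhds y) := by
      refine (A.continuous.tendsto _).comp ?_
      refine tendsto_finsetSum _ fun j _ => ?_
      exact ((tendsto_pi_nhds.1 hla) j).smul_const _
    have h2 : Tendsto (fun m => ‖A (∑ j, a (s m) j • w j) - y‖ + |b (s m) - b0| * ‖A‖) U
        (nhds 0) := by
      have h3 := (h1.sub_const y).norm
      have h4 := ((hlb.sub_const b0).abs).mul_const ‖A‖
      simpa using h3.add h4
    filter_upwards [h2.eventually (gt_mem_nhds (show (0 : ℝ) < (d - c) / 2 by linarith))] with m hm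
    have h5 := hbad (s m)
    have h6 : A (∑ j, a (s m) j • w j + b (s m) • x (s m)) =
        (y + A (b0 • x (s m))) + ((A (∑ j, a (s m) j • w j) - y) + (b (s m) - b0) • A (x (s m))) := by
      rw [map_add, map_smul, map_smul, sub_smul]; abel
    rw [h6] at h5
    have h7 := norm_add_le (y + A (b0 • x (s m)))
      ((A (∑ j, a (s m) j • w j) - y) + (b (s m) - b0) • A (x (s m)))
    have h8 := norm_add_le (A (∑ j, a (s m) j • w j) - y) ((b (s m) - b0) • A (x (s m)))
    rw [norm_smul, Real.norm_eq_abs] at h8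
    have h9 : ‖A (x (s m))‖ ≤ ‖A‖ := A.unit_le_opNorm _ (hx _)
    have h10 := mul_le_mul_of_nonneg_left h9 (abs_nonneg (b (s m) - b0))
    linarith
  haveI := net_neBot N
  have hge : (c + d) / 2 ≤ Filter.limsup (fun i => ‖y + A (N.toFun i)‖) N.F := by
    refine le_limsup_of_frequently_le ?_ ?_
    · exact ((ultraNet_tendsto U _).eventually hd).frequently
    · refine isBoundedUnder_of ⟨‖y‖ + ‖A‖, fun p => ?_⟩
      exact (norm_add_le _ _).trans (by gcongr; exact A.unit_le_opNorm _ (hball p))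
  have : max ‖y‖ (C' * 1) ≤ c := max_le hyc (by linarith)
  linarith

/-- The increasing constants. -/
noncomputable def cst (C' C : ℝ) (n : ℕ) : ℝ := C - (C - C') * (1 / 2) ^ n

lemma est_of_lt (A : X →L[ℝ] Y) {C' C : ℝ} (h0 : 0 < C') (hCC : C' < C)
    (hC : ∀ (y : Y) (σ : ℝ), 0 < σ →
      ∀ N : Net X, NetInBall N σ → WeaklyNullNet N →
      Filter.limsup (fun i => ‖y + A (N.toFun i)‖) N.F ≤ max ‖y‖ (C' * σ)) :
    SatisfiesUpperTreeEst A ⊤ C := by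
  intro x hx
  let B : Set (List (WNbhd X)) := {t | ∀ a : ℕ → ℝ, (∀ i < t.length, |a i| ≤ 1) →
      ‖A (∑ i ∈ Finset.range t.length, a i • x (t.take (i + 1)))‖ ≤ cst C' C t.length}
  have hstep : ∀ t ∈ B, Eventual {u | t ++ [u] ∈ B} := by
    intro t ht hcof
    let ι := {u : WNbhd X // t ++ [u] ∉ B}
    have hbad : ∀ u : ι, ∃ a : ℕ → ℝ, (∀ i < t.length + 1, |a i| ≤ 1) ∧
        cst C' C (t.length + 1) < ‖A (∑ i ∈ Finset.range t.length, a i • x (t.take (i + 1))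
          + a t.length • x (t ++ [u.1]))‖ := by
      intro u
      have h1 := u.2
      simp only [B, Set.mem_setOf_eq, not_forall, not_le, List.length_append,
        List.length_singleton] at h1
      obtain ⟨a, ha, h2⟩ := h1
      refine ⟨a, ha, ?_⟩
      rw [Finset.sum_range_succ] at h2
      have e1 : ∑ i ∈ Finset.range t.length, a i • x ((t ++ [u.1]).take (i + 1)) =
          ∑ i ∈ Finset.range t.length, a i • x (t.take (i + 1)) := by
        refine Finset.sum_congr rfl fun i hi => ?_
        have := Finset.mem_range.1 hi
        rw [List.take_append_of_le_length (by omega)]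
      have e2 : (t ++ [u.1]).take (t.length + 1) = t ++ [u.1] :=
        List.take_of_length_le (by simp)
      rw [e1, e2] at h2
      exact h2
    choose a ha hbad using hbad
    have hp : (0 : ℝ) < (1 / 2) ^ t.length := by positivity
    refine main_step A (C' := C') (c := cst C' C t.length) (d := cst C' C (t.length + 1))
      ?_ ?_ hC (fun i : Fin t.length => x (t.take (i + 1))) ?_
      (fun u : ι => x (t ++ [u.1])) (fun u => (hx t u.1).1) ?_
      (fun u i => a u i) (fun u => a u t.length) (fun u i => ha u i (by omega))
      (fun u => ha u _ (by omega)) ?_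
    · have : ((1 : ℝ) / 2) ^ t.length ≤ 1 := pow_le_one₀ (by norm_num) (by norm_num)
      unfold cst
      nlinarith
    · unfold cst
      rw [pow_succ]
      nlinarith
    · intro a ha
      have := ht (fun i => if h : i < t.length then a ⟨i, h⟩ else 0) (by
        intro i hi
        simpa [hi] using ha ⟨i, hi⟩)
      rw [Finset.sum_range] at this
      simpa using this
    · intro Fs ε hε
      obtain ⟨v, hv, huv⟩ := hcof ((Fs, ⟨ε, hε⟩) : Finset (X →L[ℝ] ℝ) × {ε : ℝ // 0 < ε})
      exact ⟨⟨v, hv⟩, fun f hf => huv (hx t v).2 f hf⟩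
    · intro u
      have := hbad u
      rwa [Finset.sum_range] at this
  refine ⟨B, ?_, ?_, fun t ht _ => hstep t ht⟩
  · intro t ht a ha
    refine (ht a (by simpa [pBall] using ha)).trans ?_
    have hp : (0 : ℝ) < (1 / 2) ^ t.length := by positivity
    unfold cst
    nlinarith
  · have := hstep [] (by
      intro a _
      simp [cst, h0.le])
    simpa using this

theorem upperTreeConst_le_tInf [CompleteSpace X] [CompleteSpace Y]
    (A : X →L[ℝ] Y) (hfin : tInf A < ⊤) :
    (∀ C : ℝ, tInf A < ENNReal.ofReal C → SatisfiesUpperTreeEst A ⊤ C) ∧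
      upperTreeConst A ⊤ ≤ tInf A := by
  have h1 : ∀ C : ℝ, tInf A < ENNReal.ofReal C → SatisfiesUpperTreeEst A ⊤ C := by
    intro C hC
    obtain ⟨_, ⟨C', ⟨h0, hC'⟩, rfl⟩, hlt⟩ := sInf_lt_iff.1 hC
    exact est_of_lt A h0 (ENNReal.ofReal_lt_ofReal_iff'.1 hlt).1 hC'
  refine ⟨h1, le_of_forall_gt fun r hr => ?_⟩
  obtain ⟨q, hq, hqr⟩ := exists_between hr
  have hqt : q ≠ ⊤ := hqr.ne_top
  have hq0 : 0 < q.toReal := ENNReal.toReal_pos hq.ne_bot hqt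
  refine lt_of_le_of_lt (sInf_le ⟨q.toReal, ⟨hq0, h1 _ ?_⟩, rfl⟩) ?_
  · rwa [ENNReal.ofReal_toReal hqt]
  · rwa [ENNReal.ofReal_toReal hqt]
end
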